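/- Let d₀, d₁ : V → V be the J₊-graded pieces of the Table 1 differential. There do not exist elements x₀, x₁ of V, each an 𝔽₂-linear combination of the twelve source generators, such that d₀(x₀) + d₁(x₁) = e(1,1,1,1,1) and d₀(x₁) = 0. (This shows that the spectral order bound of 2 obtained from the chain computed in the paper cannot be improved to 1 using that chain.) -/

import Mathlib

/-- Quintuples of natural numbers, indexing generators of the Heegaard Floer complex. -/
abbrev G : Type := ℕ × ℕ × ℕ × ℕ × ℕ

/-- The free 𝔽₂-vector space on quintuples of natural numbers. -/
abbrev V : Type := G →₀ ZMod 2

/-- Basis vectors of `V`. -/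
noncomputable def e (g : G) : V := Finsupp.single g 1

/-- The `J₊ = 0` piece of the Table 1 differential, given on basis vectors. -/
noncomputable def d0Fun : G → V
  | (1,2,2,1,1) => e (1,1,1,1,1) + e (1,3,2,1,1)
  | (2,4,2,1,1) => e (1,3,2,1,1) + e (3,4,2,1,1)
  | (6,4,5,1,1) => e (9,1,5,1,1)
  | (9,1,4,2,1) => e (9,1,5,1,1) + e (9,1,3,2,1)
  | (9,15,2,2,1) => e (9,1,3,2,1) + e (9,14,2,2,1)
  | (2,5,2,5,1) => e (3,5,2,5,1) + e (1,6,2,5,1)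
  | (17,4,2,5,1) => e (16,4,2,5,1) + e (1,6,2,5,1) + e (18,3,2,5,1)
  | (18,2,2,5,1) => e (18,3,2,5,1) + e (18,1,1,5,1)
  | (18,1,1,4,2) => e (18,1,1,5,1) + e (18,1,1,3,2)
  | (18,1,10,2,2) => e (18,1,1,3,2) + e (18,1,9,2,2)
  | _ => 0

/-- The `J₊ = 2` piece of the Table 1 differential, given on basis vectors. -/
noncomputable def d1Fun : G → V
  | (6,4,5,1,1) => e (3,4,2,1,1)
  | (9,11,2,5,1) => e (9,14,2,2,1) + e (16,4,2,5,1) + e (3,5,2,5,1)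
  | (18,1,5,6,2) => e (18,1,9,2,2)
  | _ => 0

/-- The `J₊ = 0` piece of the Table 1 differential as an 𝔽₂-linear map. -/
noncomputable def d0 : V →ₗ[ZMod 2] V := Finsupp.lift V (ZMod 2) G d0Fun

/-- The `J₊ = 2` piece of the Table 1 differential as an 𝔽₂-linear map. -/
noncomputable def d1 : V →ₗ[ZMod 2] V := Finsupp.lift V (ZMod 2) G d1Fun

/-- The `J₊ = 4` piece of the Table 1 differential: the zero map. -/
noncomputable def d2 : V →ₗ[ZMod 2] V := 0


/-- The twelve source generators of Table 1. -/
def sources : Set G :=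
  { (1,2,2,1,1), (2,4,2,1,1), (6,4,5,1,1), (9,1,4,2,1), (9,15,2,2,1), (9,11,2,5,1),
    (2,5,2,5,1), (17,4,2,5,1), (18,2,2,5,1), (18,1,1,4,2), (18,1,10,2,2), (18,1,5,6,2) }

/-- A functional vanishing on the image of `d0`. -/
noncomputable def phi : V →ₗ[ZMod 2] ZMod 2 :=
  Finsupp.lapply (1,1,1,1,1) + Finsupp.lapply (1,3,2,1,1) + Finsupp.lapply (3,4,2,1,1)

/-- A functional whose pullback by `d0` is the pullback of `phi` by `d1`. -/
noncomputable def psi : V →ₗ[ZMod 2] ZMod 2 :=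
  Finsupp.lapply (9,1,5,1,1) + Finsupp.lapply (9,1,3,2,1) + Finsupp.lapply (9,14,2,2,1)

theorem two_zmod : (1 : ZMod 2) + 1 = 0 := by decide

theorem phi_d0Fun (g : G) : phi (d0Fun g) = 0 := by
  unfold d0Fun
  split <;> simp [phi, e, Finsupp.single_apply, two_zmod]

theorem phi_d1Fun (g : G) : phi (d1Fun g) = if g = (6,4,5,1,1) then 1 else 0 := by
  unfold d1Fun
  split <;> simp_all [phi, e, Finsupp.single_apply]

theorem psi_d0Fun (g : G) : psi (d0Fun g) = if g = (6,4,5,1,1) then 1 else 0 := by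
  unfold d0Fun
  split <;> simp_all [psi, e, Finsupp.single_apply, two_zmod]

theorem phi_d0 (x : V) : phi (d0 x) = 0 := by
  simp [d0, Finsupp.lift_apply, Finsupp.sum, map_sum, phi_d0Fun]

theorem phi_d1 (x : V) : phi (d1 x) = psi (d0 x) := by
  simp only [d0, d1, Finsupp.lift_apply, Finsupp.sum, map_sum, map_smul, phi_d1Fun, psi_d0Fun]

/-- There is no pair of 𝔽₂-linear combinations `x₀, x₁` of the twelve source generators
with `d₀ x₀ + d₁ x₁ = e(1,1,1,1,1)` and `d₀ x₁ = 0`: the spectral order bound of 2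
obtained from the chain computed in the paper cannot be improved to 1 using that chain. -/
theorem no_spectral_order_one_witness :
    ¬ ∃ x₀ x₁ : V,
      x₀ ∈ Submodule.span (ZMod 2) (e '' sources) ∧
      x₁ ∈ Submodule.span (ZMod 2) (e '' sources) ∧
      d0 x₀ + d1 x₁ = e (1,1,1,1,1) ∧ d0 x₁ = 0 := by
  rintro ⟨x₀, x₁, -, -, h, h'⟩
  have h2 := congrArg phi h
  rw [map_add, phi_d0, phi_d1, h', map_zero] at h2
  simp [phi, e, Finsupp.single_apply] at h2
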